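/- Let A be a gamp, I an ideal of Ã, and suppose A is distance-generated and congruence-tractable. Then the quotient gamp A/I is congruence-tractable. -/

import Mathlib

/-- An ideal of a join-semilattice with zero: a lower subset containing `⊥`
closed under binary joins. -/
structure SemIdeal (S : Type*) [SemilatticeSup S] [OrderBot S] where
  carrier : Set S
  bot_mem : ⊥ ∈ carrier
  lower : ∀ {x y : S}, x ≤ y → y ∈ carrier → x ∈ carrier
  sup_mem : ∀ {x y : S}, x ∈ carrier → y ∈ carrier → x ⊔ y ∈ carrier

namespace SemIdeal

variable {S : Type*} [SemilatticeSup S] [OrderBot S] (I : SemIdeal S)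

/-- The congruence `θ_I` associated with an ideal. -/
def setoid : Setoid S where
  r x y := ∃ u ∈ I.carrier, x ⊔ u = y ⊔ u
  iseqv := by
    refine ⟨fun x => ⟨⊥, I.bot_mem, rfl⟩, ?_, ?_⟩
    · rintro x y ⟨u, hu, h⟩
      exact ⟨u, hu, h.symm⟩
    · rintro x y z ⟨u, hu, h1⟩ ⟨v, hv, h2⟩
      refine ⟨u ⊔ v, I.sup_mem hu hv, ?_⟩
      calc x ⊔ (u ⊔ v) = x ⊔ u ⊔ v := (sup_assoc ..).symm
        _ = y ⊔ u ⊔ v := by rw [h1]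
        _ = y ⊔ v ⊔ u := sup_right_comm ..
        _ = z ⊔ v ⊔ u := by rw [h2]
        _ = z ⊔ (u ⊔ v) := by rw [sup_assoc, sup_comm v u]

/-- The quotient semilattice `S/I`. -/
def Quot : Type _ := Quotient I.setoid

/-- The canonical projection `S → S/I`. -/
def mkQ (a : S) : I.Quot := Quotient.mk I.setoid a

instance : Max I.Quot :=
  ⟨fun q1 q2 => Quotient.liftOn₂ q1 q2 (fun a b => I.mkQ (a ⊔ b)) (by
    rintro a b a' b' ⟨u, hu, h1⟩ ⟨v, hv, h2⟩
    refine Quotient.sound ⟨u ⊔ v, I.sup_mem hu hv, ?_⟩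
    calc a ⊔ b ⊔ (u ⊔ v) = (a ⊔ u) ⊔ (b ⊔ v) := sup_sup_sup_comm ..
      _ = (a' ⊔ u) ⊔ (b' ⊔ v) := by rw [h1, h2]
      _ = a' ⊔ b' ⊔ (u ⊔ v) := (sup_sup_sup_comm ..).symm)⟩

theorem mkQ_sup (a b : S) : I.mkQ a ⊔ I.mkQ b = I.mkQ (a ⊔ b) := rfl

instance : SemilatticeSup I.Quot :=
  SemilatticeSup.mk'
    (fun q1 q2 => Quotient.inductionOn₂ q1 q2 fun a b => by
      change I.mkQ (a ⊔ b) = I.mkQ (b ⊔ a); rw [sup_comm])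
    (fun q1 q2 q3 => Quotient.inductionOn₃ q1 q2 q3 fun a b c => by
      change I.mkQ (a ⊔ b ⊔ c) = I.mkQ (a ⊔ (b ⊔ c)); rw [sup_assoc])
    (fun q => Quotient.inductionOn q fun a => by
      change I.mkQ (a ⊔ a) = I.mkQ a; rw [sup_idem])

instance : OrderBot I.Quot where
  bot := I.mkQ ⊥
  bot_le := fun q => Quotient.inductionOn q fun a =>
    sup_eq_right.mp (by change I.mkQ (⊥ ⊔ a) = I.mkQ a; rw [bot_sup_eq])

end SemIdeal

/-- A similarity type: a set of operation symbols with arities. -/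
structure Signature where
  ops : Type
  arity : ops → ℕ

/-- Terms of similarity type `σ` with variables in `V`. -/
inductive Term (σ : Signature) (V : Type*) : Type _ where
  | var : V → Term σ V
  | op : (o : σ.ops) → (Fin (σ.arity o) → Term σ V) → Term σ V

/-- A partial algebra of similarity type `σ` on the set `A`: each operation
symbol gets a domain of definition and a partial operation. -/
structure PartAlg (σ : Signature) (A : Type*) where
  Dom : ∀ o : σ.ops, Set ((Fin (σ.arity o)) → A)
  op : ∀ (o : σ.ops) (x : Fin (σ.arity o) → A), x ∈ Dom o → A

/-- `EvalR P asg t a` : the term `t` is defined in the partial algebra `P` under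
the assignment `asg` and evaluates to `a`. -/
inductive EvalR {σ : Signature} {A V : Type*} (P : PartAlg σ A) (asg : V → A) :
    Term σ V → A → Prop where
  | var (v : V) : EvalR P asg (.var v) (asg v)
  | op (o : σ.ops) (ts : Fin (σ.arity o) → Term σ V) (vals : Fin (σ.arity o) → A)
      (h : ∀ i, EvalR P asg (ts i) (vals i)) (hd : vals ∈ P.Dom o) :
      EvalR P asg (.op o ts) (P.op o vals hd)

/-- A morphism of partial algebras. -/
def IsPartHom {σ : Signature} {A B : Type*} (PA : PartAlg σ A) (PB : PartAlg σ B)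
    (f : A → B) : Prop :=
  ∀ (o : σ.ops) (x : Fin (σ.arity o) → A) (hx : x ∈ PA.Dom o),
    ∃ h : (fun i => f (x i)) ∈ PB.Dom o, PB.op o (fun i => f (x i)) h = f (PA.op o x hx)

/-- A semilattice-valued distance making `(A, δ, S)` a pregamp. -/
structure IsPregamp {σ : Signature} {A S : Type*} [SemilatticeSup S] [OrderBot S]
    (P : PartAlg σ A) (δ : A → A → S) : Prop where
  eq_bot : ∀ x y : A, δ x y = ⊥ ↔ x = y
  symm : ∀ x y : A, δ x y = δ y x
  triangle : ∀ x y z : A, δ x y ≤ δ x z ⊔ δ z y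
  compat : ∀ (o : σ.ops) (x y : Fin (σ.arity o) → A) (hx : x ∈ P.Dom o) (hy : y ∈ P.Dom o),
    δ (P.op o x hx) (P.op o y hy) ≤ Finset.univ.sup fun k => δ (x k) (y k)

/-- `Q` is the canonical quotient partial algebra structure of `P` by the
equivalence `r`. -/
def IsQuotStruct {σ : Signature} {A : Type*} (P : PartAlg σ A) (r : A → A → Prop)
    (Q : PartAlg σ (Quot r)) : Prop :=
  (∀ o : σ.ops, Q.Dom o = {q | ∃ x ∈ P.Dom o, (fun i => Quot.mk r (x i)) = q}) ∧
  ∀ (o : σ.ops) (x : Fin (σ.arity o) → A) (hx : x ∈ P.Dom o)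
    (hq : (fun i => Quot.mk r (x i)) ∈ Q.Dom o),
    Q.op o _ hq = Quot.mk r (P.op o x hx)

/-- A Mal'cev-type chain of terms witnessing a congruence containment, with all
evaluations defined in the partial algebra. -/
def MalcevChain {σ : Signature} {A V : Type*} (P : PartAlg σ A) (asg1 asg2 : V → A)
    (n : ℕ) (t : ℕ → Term σ V) (a b : A) : Prop :=
  ∃ av bv : ℕ → A,
    (∀ j ≤ n, EvalR P asg1 (t j) (av j)) ∧
    (∀ j < n, EvalR P asg2 (t j) (bv j)) ∧
    av 0 = a ∧ av n = b ∧ ∀ j < n, bv j = av (j + 1)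

/-- The gamp `(A*, A, δ, S)` is congruence-tractable. -/
def CongTract {σ : Signature} {A S : Type*} [SemilatticeSup S] [OrderBot S]
    (P : PartAlg σ A) (Astar : Set A) (δ : A → A → S) : Prop :=
  ∀ (m : ℕ) (a b : A), a ∈ Astar → b ∈ Astar → ∀ x y : Fin m → A,
    (∀ k, x k ∈ Astar) → (∀ k, y k ∈ Astar) →
    δ a b ≤ (Finset.univ.sup fun k => δ (x k) (y k)) →
    ∃ n : ℕ, 0 < n ∧ ∃ (z : ℕ → A) (t : ℕ → Term σ (Fin m ⊕ Fin m ⊕ ℕ)),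
      MalcevChain P (Sum.elim x (Sum.elim y z)) (Sum.elim y (Sum.elim x z)) n t a b

/-- The gamp `(A*, A, δ, S)` is distance-generated. -/
def DistGen {A S : Type*} [SemilatticeSup S] [OrderBot S]
    (Astar : Set A) (δ : A → A → S) : Prop :=
  ∀ α : S, ∃ (m : ℕ) (x y : Fin m → A),
    (∀ k, x k ∈ Astar ∧ y k ∈ Astar) ∧ α = Finset.univ.sup fun k => δ (x k) (y k)

/-- Substitution of variables along a map. -/
def Term.rename {σ : Signature} {V W : Type*} (ρ : V → W) : Term σ V → Term σ W
  | .var v => .var (ρ v)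
  | .op o ts => .op o fun i => (ts i).rename ρ

theorem EvalR.rename {σ : Signature} {A V W : Type*} {P : PartAlg σ A} {ρ : V → W}
    {asg : W → A} {t : Term σ V} {a : A} (h : EvalR P (asg ∘ ρ) t a) :
    EvalR P asg (t.rename ρ) a := by
  induction h with
  | var v => exact .var (ρ v)
  | op o ts vals _ hd ih => exact .op o _ vals ih hd

theorem EvalR.map {σ : Signature} {A B V : Type*} {P : PartAlg σ A} {Q : PartAlg σ B}
    {f : A → B} (hf : IsPartHom P Q f) {asg : V → A} {t : Term σ V} {a : A}
    (h : EvalR P asg t a) : EvalR Q (f ∘ asg) t (f a) := by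
  induction h with
  | var v => exact .var (asg := f ∘ asg) v
  | op o ts vals _ hd ih =>
    obtain ⟨hd', heq⟩ := hf o vals hd
    rw [← heq]
    exact .op o ts _ ih hd'

theorem IsQuotStruct.isPartHom_mk {σ : Signature} {A : Type*} {P : PartAlg σ A}
    {r : A → A → Prop} {Q : PartAlg σ (Quot r)} (h : IsQuotStruct P r Q) :
    IsPartHom P Q (Quot.mk r) := by
  intro o x hx
  have hd : (fun i => Quot.mk r (x i)) ∈ Q.Dom o := by
    rw [h.1 o]
    exact ⟨x, hx, rfl⟩
  exact ⟨hd, h.2 o x hx hd⟩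

theorem MalcevChain.map_rename {σ : Signature} {A B V W : Type*} {P : PartAlg σ A}
    {Q : PartAlg σ B} {f : A → B} (hf : IsPartHom P Q f) (ρ : V → W)
    {asg₁ asg₂ : V → A} {asg₁' asg₂' : W → B}
    (h₁ : f ∘ asg₁ = asg₁' ∘ ρ) (h₂ : f ∘ asg₂ = asg₂' ∘ ρ)
    {n : ℕ} {t : ℕ → Term σ V} {a b : A} (h : MalcevChain P asg₁ asg₂ n t a b) :
    MalcevChain Q asg₁' asg₂' n (fun j => (t j).rename ρ) (f a) (f b) := by
  obtain ⟨av, bv, hav, hbv, rfl, rfl, hab⟩ := h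
  refine ⟨f ∘ av, f ∘ bv, fun j hj => ?_, fun j hj => ?_, rfl, rfl,
    fun j hj => congrArg f (hab j hj)⟩
  · exact EvalR.rename (h₁ ▸ (hav j hj).map hf)
  · exact EvalR.rename (h₂ ▸ (hbv j hj).map hf)

namespace SemIdeal

variable {S : Type*} [SemilatticeSup S] [OrderBot S] (I : SemIdeal S)

theorem mkQ_le_mkQ_iff {a b : S} : I.mkQ a ≤ I.mkQ b ↔ ∃ u ∈ I.carrier, a ≤ b ⊔ u := by
  rw [← sup_eq_right, mkQ_sup]
  constructor
  · intro h
    obtain ⟨u, hu, h⟩ := Quotient.exact h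
    exact ⟨u, hu, h ▸ le_sup_left.trans le_sup_left⟩
  · rintro ⟨u, hu, h⟩
    refine Quotient.sound ⟨u, hu, ?_⟩
    rw [sup_assoc, sup_eq_right.mpr h]

theorem mkQ_finset_sup {ι : Type*} (s : Finset ι) (g : ι → S) :
    I.mkQ (s.sup g) = s.sup fun i => I.mkQ (g i) :=
  Finset.apply_sup_eq_sup_comp I.mkQ (fun _ _ => rfl) rfl

end SemIdeal

/-- Keeps the first `m` variables of each of the two blocks, and sends the last `l` variables of
both blocks to the first `l` parameters, the old parameters being shifted by `l`. -/
def collapseVars (m l : ℕ) :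
    Fin (m + l) ⊕ Fin (m + l) ⊕ ℕ → Fin m ⊕ Fin m ⊕ ℕ :=
  Sum.elim (Fin.append .inl fun j => .inr (.inr j))
    (Sum.elim (Fin.append (fun k => .inr (.inl k)) fun j => .inr (.inr j))
      fun i => .inr (.inr (l + i)))

theorem comp_elim_eq_elim_comp_collapseVars {A B : Type*} (f : A → B) {m l : ℕ}
    (x y : Fin m → A) (p q r : Fin l → A) (z : ℕ → A)
    (hp : ∀ j, f (p j) = f (r j)) (hq : ∀ j, f (q j) = f (r j)) :
    f ∘ Sum.elim (Fin.append x p) (Sum.elim (Fin.append y q) z) =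
      Sum.elim (f ∘ x) (Sum.elim (f ∘ y)
        fun i => f (if h : i < l then r ⟨i, h⟩ else z (i - l))) ∘ collapseVars m l := by
  funext v
  rcases v with v | v | i
  · induction v using Fin.addCases <;> simp [collapseVars, hp]
  · induction v using Fin.addCases <;> simp [collapseVars, hq]
  · simp [collapseVars]

theorem stmt18 {σ : Signature} {A S : Type*} [SemilatticeSup S] [OrderBot S]
    (P : PartAlg σ A) (Astar : Set A) (δ : A → A → S) (hP : IsPregamp P δ)
    (hgen : DistGen Astar δ) (htract : CongTract P Astar δ) (I : SemIdeal S) :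
    ∀ Q : PartAlg σ (Quot fun x y : A => δ x y ∈ I.carrier),
      IsQuotStruct P (fun x y : A => δ x y ∈ I.carrier) Q →
      ∀ δ' : (Quot fun x y : A => δ x y ∈ I.carrier) →
             (Quot fun x y : A => δ x y ∈ I.carrier) → I.Quot,
        (∀ x y : A, δ' (Quot.mk (fun x y : A => δ x y ∈ I.carrier) x)
            (Quot.mk (fun x y : A => δ x y ∈ I.carrier) y) = I.mkQ (δ x y)) →
        CongTract Q (Quot.mk (fun x y : A => δ x y ∈ I.carrier) '' Astar) δ' := by
  intro Q hQ δ' hδ' m a' b' ha' hb' x' y' hx' hy' hle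
  obtain ⟨a, ha, rfl⟩ := ha'
  obtain ⟨b, hb, rfl⟩ := hb'
  choose x hx hxx using hx'
  choose y hy hyy using hy'
  obtain rfl := funext hxx
  obtain rfl := funext hyy
  simp only [hδ'] at hle
  rw [← I.mkQ_finset_sup, I.mkQ_le_mkQ_iff] at hle
  obtain ⟨u, hu, hle⟩ := hle
  obtain ⟨l, p, q, hpq, rfl⟩ := hgen u
  have hmk (j : Fin l) : Quot.mk (fun x y : A => δ x y ∈ I.carrier) (q j) = Quot.mk _ (p j) :=
    (Quot.sound (I.lower (Finset.le_sup (f := fun k => δ (p k) (q k)) (Finset.mem_univ j)) hu)).symm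
  obtain ⟨n, hn, z, t, ht⟩ := htract (m + l) a b ha hb (Fin.append x p) (Fin.append y q)
    (fun k => by induction k using Fin.addCases <;> simp [hx, hpq])
    (fun k => by induction k using Fin.addCases <;> simp [hy, hpq])
    (hle.trans (sup_le
      (Finset.sup_le fun k _ => by
        simpa using Finset.le_sup (f := fun k => δ (Fin.append x p k) (Fin.append y q k))
          (Finset.mem_univ (Fin.castAdd l k)))
      (Finset.sup_le fun k _ => by
        simpa using Finset.le_sup (f := fun k => δ (Fin.append x p k) (Fin.append y q k))
          (Finset.mem_univ (Fin.natAdd m k)))))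
  exact ⟨n, hn, _, _, ht.map_rename hQ.isPartHom_mk (collapseVars m l)
    (comp_elim_eq_elim_comp_collapseVars _ x y p q p z (fun _ => rfl) hmk)
    (comp_elim_eq_elim_comp_collapseVars _ y x q p p z hmk fun _ => rfl)⟩
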